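/- Let n ≥ 3 and let Q_{2^n} be the generalized quaternion group of order 2^n. Then |CD(Q_{2^n})| ≠ |L(Q_{2^n})| - 2. -/

import Mathlib

/-- The Chermak-Delgado measure of a subgroup `H` of `G`: `m_G(H) = |H| * |C_G(H)|`. -/
noncomputable def cdMeasure (G : Type*) [Group G] (H : Subgroup G) : ℕ :=
  Nat.card H * Nat.card (Subgroup.centralizer (H : Set G))

/-- The Chermak-Delgado lattice of `G`: the set of subgroups whose Chermak-Delgado
measure is maximal among all subgroups of `G`. -/
def cdLattice (G : Type*) [Group G] : Set (Subgroup G) :=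
  {H | ∀ K : Subgroup G, cdMeasure G K ≤ cdMeasure G H}

open Subgroup

section cdMeasure

variable {G : Type*} [Group G]

theorem cdMeasure_eq_of_le_center {H : Subgroup G} (hH : H ≤ center G) :
    cdMeasure G H = Nat.card H * Nat.card G := by
  rw [cdMeasure, centralizer_eq_top_iff_subset.mpr hH, card_top]

theorem cdMeasure_top : cdMeasure G ⊤ = Nat.card G * Nat.card (center G) := by
  rw [cdMeasure, coe_top, centralizer_univ, card_top]

theorem card_sq_le_cdMeasure [Finite G] (H : Subgroup G) [IsMulCommutative H] :
    Nat.card H ^ 2 ≤ cdMeasure G H := by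
  rw [sq, cdMeasure]
  exact Nat.mul_le_mul_left _ (card_le_of_le (le_centralizer H))

end cdMeasure

namespace QuaternionGroup

theorem mem_center_iff {m : ℕ} (hm : 2 ≤ m) {g : QuaternionGroup m} :
    g ∈ center (QuaternionGroup m) ↔ g = 1 ∨ g = a m := by
  have : NeZero m := ⟨by omega⟩
  have hmm : (m : ZMod (2 * m)) + m = 0 := by
    rw [← two_mul]; exact_mod_cast ZMod.natCast_self (2 * m)
  rw [Subgroup.mem_center_iff]
  constructor
  · intro h
    rcases g with i | i
    · have h0 : i + i = 0 := by simpa [eq_neg_iff_add_eq_zero] using h (xa 0)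
      have hdvd : 2 * m ∣ 2 * i.val := by
        rw [← ZMod.natCast_eq_zero_iff]
        simpa [two_mul] using h0
      obtain ⟨k, hk⟩ := Nat.dvd_of_mul_dvd_mul_left two_pos hdvd
      have hk2 : k < 2 := by
        have := ZMod.val_lt i
        rw [hk, mul_comm] at this
        exact Nat.lt_of_mul_lt_mul_right this
      rw [← ZMod.natCast_zmod_val i, hk]
      interval_cases k <;> simp
    · have h1 : i - 1 = i + 1 := by simpa using h (a 1)
      have h2 : ((2 : ℕ) : ZMod (2 * m)) = 0 := by
        push_cast
        linear_combination -h1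
      have := Nat.le_of_dvd two_pos ((ZMod.natCast_eq_zero_iff _ _).mp h2)
      omega
  · rintro (rfl | rfl) (j | j)
    · simp
    · simp
    · simp [add_comm]
    · simp only [xa_mul_a, a_mul_xa, xa.injEq]
      linear_combination hmm

theorem card_center {m : ℕ} (hm : 2 ≤ m) : Nat.card (center (QuaternionGroup m)) = 2 := by
  have hne : (1 : QuaternionGroup m) ≠ a m := by
    rw [one_def, Ne, a.injEq, eq_comm, ZMod.natCast_eq_zero_iff]
    intro h
    have := Nat.le_of_dvd (by omega) h
    omega
  have hset : (center (QuaternionGroup m) : Set (QuaternionGroup m)) = {1, a m} :=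
    Set.ext fun g => mem_center_iff hm
  rw [← SetLike.coe_sort_coe, hset, Nat.card_coe_set_eq, Set.ncard_pair hne]

theorem natCard {m : ℕ} [NeZero m] : Nat.card (QuaternionGroup m) = 4 * m := by
  rw [Nat.card_eq_fintype_card, card]

/-- When `4 ≤ m`, the subgroups `⊥`, `center` and `⊤` all lie outside the Chermak-Delgado
lattice. -/
theorem two_lt_ncard_compl_cdLattice {m : ℕ} (hm : 4 ≤ m) :
    2 < (cdLattice (QuaternionGroup m))ᶜ.ncard := by
  have : NeZero m := ⟨by omega⟩
  have hc := card_center (m := m) (by omega)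
  have hG := natCard (m := m)
  have hlow : (2 * m) ^ 2 ≤ cdMeasure _ (zpowers (a 1 : QuaternionGroup m)) := by
    have := card_sq_le_cdMeasure (zpowers (a 1 : QuaternionGroup m))
    rwa [Nat.card_zpowers, orderOf_a_one] at this
  have hnot {H : Subgroup (QuaternionGroup m)} (hH : cdMeasure _ H ≤ 8 * m) :
      H ∈ (cdLattice (QuaternionGroup m))ᶜ := fun h => by
    have := h (zpowers (a 1))
    nlinarith
  rw [Set.two_lt_ncard]
  refine ⟨⊥, hnot ?_, center _, hnot ?_, ⊤, hnot ?_, ?_, ?_, ?_⟩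
  · rw [cdMeasure_eq_of_le_center bot_le, card_bot]
    omega
  · rw [cdMeasure_eq_of_le_center le_rfl, hc]
    omega
  · rw [cdMeasure_top, hc]
    omega
  · intro h
    rw [← h, card_bot] at hc
    omega
  · exact bot_ne_top
  · intro h
    rw [h, card_top] at hc
    omega

theorem cdMeasure_bot_two : cdMeasure (QuaternionGroup 2) ⊥ = 8 := by
  rw [cdMeasure_eq_of_le_center bot_le, card_bot, natCard]

theorem mem_center_of_sq_eq_one {g : QuaternionGroup 2} (hg : g ^ 2 = 1) :
    g ∈ center (QuaternionGroup 2) := by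
  rw [Subgroup.mem_center_iff]
  revert g
  decide

/-- Every nontrivial subgroup of the quaternion group of order `8` has the same
Chermak-Delgado measure. -/
theorem cdMeasure_two_of_ne_bot {H : Subgroup (QuaternionGroup 2)} (hH : H ≠ ⊥) :
    cdMeasure (QuaternionGroup 2) H = 16 := by
  have hG : Nat.card (QuaternionGroup 2) = 2 ^ 3 := natCard
  have hc := card_center (m := 2) le_rfl
  obtain ⟨k, hk, hHk⟩ := (Nat.dvd_prime_pow Nat.prime_two).mp (hG ▸ card_subgroup_dvd_card H)
  interval_cases k
  · exact absurd (card_eq_one.mp hHk) hH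
  · have hle : H ≤ center (QuaternionGroup 2) := fun g hg => mem_center_of_sq_eq_one (by
      have := pow_card_eq_one' (x := (⟨g, hg⟩ : H))
      rw [hHk] at this
      simpa using congrArg Subtype.val this)
    rw [cdMeasure_eq_of_le_center hle, hHk, hG]
    norm_num
  · have : Fact (Nat.Prime 2) := ⟨Nat.prime_two⟩
    have : IsMulCommutative H := IsPGroup.isMulCommutative_of_card_eq_prime_sq hHk
    have hlow := card_sq_le_cdMeasure H
    rw [cdMeasure, hHk] at hlow ⊢
    obtain ⟨j, hj, hCj⟩ := (Nat.dvd_prime_pow Nat.prime_two).mp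
      (hG ▸ card_subgroup_dvd_card (centralizer (H : Set (QuaternionGroup 2))))
    have hne : j ≠ 3 := by
      rintro rfl
      have hle := card_le_of_le
        (centralizer_eq_top_iff_subset.mp (eq_top_of_card_eq _ (hCj.trans hG.symm)) :
          H ≤ center (QuaternionGroup 2))
      omega
    interval_cases j <;> omega
  · rw [eq_top_of_card_eq H (hHk.trans hG.symm), cdMeasure_top, hG, hc]
    norm_num

theorem ncard_compl_cdLattice_two_le_one :
    (cdLattice (QuaternionGroup 2))ᶜ.ncard ≤ 1 := by
  have hsub : (cdLattice (QuaternionGroup 2))ᶜ ⊆ {⊥} := fun H hH => by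
    by_contra hne
    refine hH fun K => ?_
    rw [cdMeasure_two_of_ne_bot hne]
    rcases eq_or_ne K ⊥ with rfl | hK
    · rw [cdMeasure_bot_two]
      omega
    · exact (cdMeasure_two_of_ne_bot hK).le
  simpa using Set.ncard_le_ncard hsub

end QuaternionGroup

/-- For all `n ≥ 3`, the generalized quaternion group `Q_{2^n}` (realized as
`QuaternionGroup (2^(n-2))`, which has order `2^n`) satisfies
`|CD(Q_{2^n})| ≠ |L(Q_{2^n})| - 2`. -/
theorem quaternion_cd_ne_sub_two (n : ℕ) (hn : 3 ≤ n) :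
    Nat.card (cdLattice (QuaternionGroup (2 ^ (n - 2)))) ≠
      Nat.card (Subgroup (QuaternionGroup (2 ^ (n - 2)))) - 2 := by
  have : NeZero (2 ^ (n - 2)) := ⟨by positivity⟩
  have hsum := Set.ncard_add_ncard_compl (cdLattice (QuaternionGroup (2 ^ (n - 2))))
  have hcard : 1 < Nat.card (Subgroup (QuaternionGroup (2 ^ (n - 2)))) := Finite.one_lt_card
  have hcompl : (cdLattice (QuaternionGroup (2 ^ (n - 2))))ᶜ.ncard ≤ 1 ∨
      2 < (cdLattice (QuaternionGroup (2 ^ (n - 2))))ᶜ.ncard := by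
    rcases hn.eq_or_lt with rfl | hn
    · exact .inl QuaternionGroup.ncard_compl_cdLattice_two_le_one
    · exact .inr <| QuaternionGroup.two_lt_ncard_compl_cdLattice
        (Nat.pow_le_pow_right two_pos (show 2 ≤ n - 2 by omega))
  rw [Nat.card_coe_set_eq]
  omega
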